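/- Let m, d ≥ 1, C > 0, n ∈ ℕ, and for each i ∈ Λ = {1,…,m} let ψ(·,·,i) : ℝ×ℝ^d → ℝ satisfy |ψ(y,z,i) − ψ(y',z',i)| ≤ C(|y−y'| + |z−z'|) for all y,y',z,z'. Let k : Λ×Λ → ℝ. Define ψ̄ⁿ : ℝ^m × ℝ^{m×d} → ℝ^m by ψ̄ⁿ(y,z)_i = ψ(y_i, z_i, i) + n·∑_{l=1}^m (y_i − y_l + k(i,l))⁻. Then for all y, y' ∈ ℝ^m and z, z' ∈ ℝ^{m×d}: −4⟨y⁻, ψ̄ⁿ(y⁺ + y', z) − ψ̄ⁿ(y', z')⟩ ≤ 2·∑_{i=1}^m 1_{{y_i < 0}} |z_i − z'_i|² + 2C²|y⁻|². -/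

import Mathlib

/-- The penalized generator
`ψ̄ⁿ(y,z)_i = ψ(y_i,z_i,i) + n ∑ₗ (y_i - y_l + k(i,l))⁻`
satisfies the structural condition
`-4⟨y⁻, ψ̄ⁿ(y⁺+y',z) - ψ̄ⁿ(y',z')⟩ ≤ 2 ∑ᵢ 1_{yᵢ<0}|zᵢ-z'ᵢ|² + 2C²|y⁻|²`. -/
theorem stmt_6 (m d : ℕ) (hm : 1 ≤ m) (hd : 1 ≤ d) (C : ℝ) (hC : 0 < C)
    (n : ℕ)
    (ψ : ℝ → (Fin d → ℝ) → Fin m → ℝ)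
    (hLip : ∀ (i : Fin m) (y y' : ℝ) (z z' : Fin d → ℝ),
      |ψ y z i - ψ y' z' i| ≤ C * (|y - y'| + Real.sqrt (∑ j, (z j - z' j)^2)))
    (k : Fin m → Fin m → ℝ)
    (y y' : Fin m → ℝ) (z z' : Fin m → Fin d → ℝ) :
    -4 * ∑ i, max (-(y i)) 0 *
        ((ψ (max (y i) 0 + y' i) (z i) i
            + (n : ℝ) * ∑ l, max (-((max (y i) 0 + y' i) - (max (y l) 0 + y' l) + k i l)) 0)
          - (ψ (y' i) (z' i) i
            + (n : ℝ) * ∑ l, max (-(y' i - y' l + k i l)) 0))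
      ≤ 2 * ∑ i, (if y i < 0 then (1:ℝ) else 0) * (∑ j, (z i j - z' i j)^2)
        + 2 * C^2 * ∑ i, (max (-(y i)) 0)^2 := by
  rw [Finset.mul_sum, Finset.mul_sum, Finset.mul_sum, ← Finset.sum_add_distrib]
  refine Finset.sum_le_sum fun i _ => ?_
  by_cases hi : y i < 0
  · have e1 : max (y i) 0 = 0 := max_eq_right hi.le
    have e2 : max (-(y i)) 0 = -(y i) := max_eq_left (by linarith)
    rw [if_pos hi, e1, e2]
    have hsum : ∑ l, max (-(y' i - y' l + k i l)) 0
        ≤ ∑ l, max (-((0 + y' i) - (max (y l) 0 + y' l) + k i l)) 0 := by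
      refine Finset.sum_le_sum fun l _ => max_le_max ?_ le_rfl
      have := le_max_right (y l) 0
      linarith
    have hn := mul_le_mul_of_nonneg_left hsum (Nat.cast_nonneg (α := ℝ) n)
    have hL := hLip i (0 + y' i) (y' i) (z i) (z' i)
    have h0 : |0 + y' i - y' i| = 0 := by simp
    rw [h0, zero_add] at hL
    have hS : 0 ≤ ∑ j, (z i j - z' i j)^2 := Finset.sum_nonneg fun j _ => sq_nonneg _
    have hq := Real.sq_sqrt hS
    set s := Real.sqrt (∑ j, (z i j - z' i j)^2)
    rw [← hq]
    have hl := (abs_le.mp hL).1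
    have hD : -(C * s) ≤ (ψ (0 + y' i) (z i) i
            + (n : ℝ) * ∑ l, max (-((0 + y' i) - (max (y l) 0 + y' l) + k i l)) 0)
          - (ψ (y' i) (z' i) i
            + (n : ℝ) * ∑ l, max (-(y' i - y' l + k i l)) 0) := by
      rw [zero_add] at hl hn ⊢
      linarith
    have hm' := mul_le_mul_of_nonneg_left hD (by linarith : 0 ≤ -(y i))
    nlinarith [sq_nonneg (s - C * (-(y i)))]
  · have e2 : max (-(y i)) 0 = 0 := max_eq_right (by linarith)
    rw [if_neg hi, e2]
    simp
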